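/- arXiv:1909.10417 — 2 statements merged into one kernel-verified Lean document; each statement's English description precedes it below -/
import Mathlib

section
/- The much larger inclusion 𝐟 ⋐ 𝐭 ∩ 𝐫 holds: 𝐟 ⊊ 𝐭 ∩ 𝐫 and there exists a countable collection {D_j}_{j∈ℕ} ⊆ 𝐟 of nonempty pairwise disjoint subsets of ℕ such that for every infinite subset K ⊆ ℕ, the union ⋃_{k∈K} D_k belongs to (𝐭 ∩ 𝐫) \ 𝐟. -/
open Filter

/-- The ideal `𝐟` of all finite subsets of `ℕ`. -/
def finIdeal : Set (Set ℕ) := {A : Set ℕ | A.Finite}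

/-- `C ⊆ D mod 𝐟`: the set `C \ D` is finite. -/
def ModF (C D : Set ℕ) : Prop := (C \ D).Finite

/-- The infinite arithmetic progression `a ℕ₀ + b = {a k + b : k ∈ ℕ₀}`. -/
def apSet (a b : ℕ) : Set ℕ := {m : ℕ | ∃ k : ℕ, m = a * k + b}

/-- `ℛ`: the set of all finite unions of infinite arithmetic progressions
`⋃_{i=1}^n (a_i ℕ₀ + b_i)` with `n ∈ ℕ` and `a_i, b_i ∈ ℕ = {1, 2, 3, …}`. -/
def calR : Set (Set ℕ) :=
  {B : Set ℕ | ∃ n : ℕ, ∃ a b : Fin (n + 1) → ℕ,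
    (∀ i, 0 < a i) ∧ (∀ i, 0 < b i) ∧ B = ⋃ i, apSet (a i) (b i)}

/-- The infinite tiling `(⋃_{j=0}^∞ (T + j r)) + b` of a tile `T` of length `r`. -/
def tiling (r b : ℕ) (T : Set ℕ) : Set ℕ :=
  {m : ℕ | ∃ t ∈ T, ∃ j : ℕ, m = t + j * r + b}

/-- `𝒯`: the set of all infinite tilings `(⋃_{j=0}^∞ (T + j r)) + b` with
`r, b ∈ ℕ = {1, 2, 3, …}` and `T ⊆ {0, 1, …, r - 1}` a tile of length `r`. -/
def calT : Set (Set ℕ) :=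
  {A : Set ℕ | ∃ r b : ℕ, 0 < r ∧ 0 < b ∧
    ∃ T : Set ℕ, T ⊆ Set.Iio r ∧ A = tiling r b T}

/-- `|X ∩ [1, n]|`. -/
noncomputable def cnt (X : Set ℕ) (n : ℕ) : ℕ := Nat.card ↥(X ∩ Set.Icc 1 n)

/-- `X` has density `δ`, i.e. `d(X) := lim_{n→∞} |X ∩ [1,n]| / n = δ`. -/
def HasDensity (X : Set ℕ) (δ : ℝ) : Prop :=
  Tendsto (fun n : ℕ => (cnt X n : ℝ) / n) atTop (nhds δ)

/-- The ideal `𝐝` of all subsets of `ℕ` with density zero. -/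
def densIdeal : Set (Set ℕ) := {X : Set ℕ | HasDensity X 0}

/-- `|X ∩ [k+1, k+n]|`. -/
noncomputable def cntI (X : Set ℕ) (k n : ℕ) : ℕ := Nat.card ↥(X ∩ Set.Icc (k + 1) (k + n))

/-- `max_{k ∈ ℕ₀} |X ∩ [k+1, k+n]|`. -/
noncomputable def maxCnt (X : Set ℕ) (n : ℕ) : ℕ := sSup {m : ℕ | ∃ k : ℕ, m = cntI X k n}

/-- The ideal `𝐛` of all subsets of `ℕ` with Banach density
`b(X) := lim_{n→∞} max_{k∈ℕ₀} |X ∩ [k+1, k+n]| / n` equal to zero. -/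
def banachIdeal : Set (Set ℕ) :=
  {X : Set ℕ | Tendsto (fun n : ℕ => (maxCnt X n : ℝ) / n) atTop (nhds 0)}

/-- The tile density `tile(X) := inf { d(A) : A ∈ 𝒯, X ⊆ A mod 𝐟 }`. -/
noncomputable def tileDens (X : Set ℕ) : ℝ :=
  sInf {δ : ℝ | ∃ A ∈ calT, ModF X A ∧ HasDensity A δ}

/-- The ideal `𝐭` of all subsets of `ℕ` with tile density zero. -/
def tileIdeal : Set (Set ℕ) := {X : Set ℕ | tileDens X = 0}

/-- The Buck density `buck(X) := inf { d(B) : B ∈ ℛ, X ⊆ B mod 𝐟 }`. -/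
noncomputable def buckDens (X : Set ℕ) : ℝ :=
  sInf {δ : ℝ | ∃ B ∈ calR, ModF X B ∧ HasDensity B δ}

/-- The ideal `𝐫` of all subsets of `ℕ` whose reciprocal series converges. -/
def recipIdeal : Set (Set ℕ) := {X : Set ℕ | Summable (X.indicator fun x : ℕ => (1 : ℝ) / x)}

/-- `𝐢 ⋐ 𝐣`: `𝐣` is much larger than `𝐢`, i.e. `𝐢 ⊊ 𝐣` and there is a countable
collection `{D_j}` of nonempty pairwise disjoint members of `𝐢` such that for every
infinite `K ⊆ ℕ` the union `⋃_{k∈K} D_k` lies in `𝐣 \ 𝐢`. -/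
def MuchLarger (i j : Set (Set ℕ)) : Prop :=
  i ⊂ j ∧ ∃ D : ℕ → Set ℕ,
    (∀ n, D n ∈ i) ∧ (∀ n, (D n).Nonempty) ∧
    (∀ m n, m ≠ n → Disjoint (D m) (D n)) ∧
    (∀ K : Set ℕ, K.Infinite → (⋃ k ∈ K, D k) ∈ j ∧ (⋃ k ∈ K, D k) ∉ i)

theorem HasDensity.nonneg {X : Set ℕ} {δ : ℝ} (h : HasDensity X δ) : 0 ≤ δ :=
  ge_of_tendsto' h fun _ => by positivity

theorem tiling_singleton_zero {a : ℕ} (ha : 0 < a) :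
    tiling a a {0} = {m : ℕ | 0 < m ∧ a ∣ m} := by
  ext m
  simp only [tiling, Set.mem_singleton_iff, exists_eq_left, zero_add, Set.mem_ofPred_eq]
  constructor
  · rintro ⟨j, rfl⟩
    exact ⟨by positivity, j + 1, by ring⟩
  · rintro ⟨hm, c, rfl⟩
    obtain ⟨c, rfl⟩ := Nat.exists_eq_succ_of_ne_zero (right_ne_zero_of_mul hm.ne')
    exact ⟨c, by rw [Nat.succ_eq_add_one]; ring⟩

theorem tiling_singleton_zero_mem_calT {a : ℕ} (ha : 0 < a) : tiling a a {0} ∈ calT :=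
  ⟨a, a, ha, ha, {0}, by simpa using ha, rfl⟩

theorem cnt_tiling_singleton_zero {a : ℕ} (ha : 0 < a) (n : ℕ) :
    cnt (tiling a a {0}) n = n / a := by
  rw [cnt, tiling_singleton_zero ha, ← Nat.Ioc_filter_dvd_card_eq_div,
    ← Nat.card_eq_finsetCard]
  congr! 3 with m
  simp only [Set.mem_inter_iff, Set.mem_ofPred_eq, Set.mem_Icc, Finset.mem_filter, Finset.mem_Ioc]
  grind

theorem hasDensity_tiling_singleton_zero {a : ℕ} (ha : 0 < a) :
    HasDensity (tiling a a {0}) (a : ℝ)⁻¹ := by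
  have h := (tendsto_nat_floor_mul_div_atTop (R := ℝ) (a := (a : ℝ)⁻¹) (by positivity)).comp
    tendsto_natCast_atTop_atTop
  refine h.congr fun n => ?_
  simp only [Function.comp_apply, cnt_tiling_singleton_zero ha]
  rw [inv_mul_eq_div, Nat.floor_div_eq_div]

theorem mem_tileIdeal_of_forall_modF {X : Set ℕ}
    (h : ∀ ε > (0 : ℝ), ∃ a : ℕ, 0 < a ∧ (a : ℝ)⁻¹ < ε ∧ ModF X (tiling a a {0})) :
    X ∈ tileIdeal := by
  refine le_antisymm (le_of_forall_pos_lt_add fun ε hε => ?_)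
    (Real.sInf_nonneg fun δ ⟨_, _, _, hδ⟩ => hδ.nonneg)
  obtain ⟨a, ha, haε, hX⟩ := h ε hε
  rw [zero_add]
  refine lt_of_le_of_lt (csInf_le ⟨0, fun δ ⟨_, _, _, hδ⟩ => hδ.nonneg⟩ ?_) haε
  exact ⟨_, tiling_singleton_zero_mem_calT ha, hX, hasDensity_tiling_singleton_zero ha⟩

theorem mem_tileIdeal_of_modF_two_pow {X : Set ℕ} (hX : ModF X (Set.range (2 ^ · : ℕ → ℕ))) :
    X ∈ tileIdeal := by
  refine mem_tileIdeal_of_forall_modF fun ε hε => ?_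
  obtain ⟨k, hk⟩ := exists_pow_lt_of_lt_one hε (by norm_num : (2 : ℝ)⁻¹ < 1)
  refine ⟨2 ^ k, by positivity, by simpa using hk, ?_⟩
  refine (hX.union (Set.finite_Iio (2 ^ k))).subset ?_
  rintro x ⟨hx, hxt⟩
  rw [tiling_singleton_zero (by positivity)] at hxt
  by_cases hr : x ∈ Set.range (2 ^ · : ℕ → ℕ)
  · obtain ⟨m, rfl⟩ := hr
    refine Or.inr (Nat.pow_lt_pow_right one_lt_two (not_le.1 fun hkm => hxt ?_))
    exact ⟨by positivity, pow_dvd_pow 2 hkm⟩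
  · exact Or.inl ⟨hx, hr⟩

theorem range_two_pow_mem_recipIdeal : Set.range (2 ^ · : ℕ → ℕ) ∈ recipIdeal := by
  have hinj : Function.Injective (2 ^ · : ℕ → ℕ) := Nat.pow_right_injective le_rfl
  refine (hinj.summable_iff fun x hx => Set.indicator_of_notMem hx _).1 ?_
  refine summable_geometric_two.congr fun n => ?_
  simp [Set.indicator_of_mem]

theorem mem_recipIdeal_of_modF {X Y : Set ℕ} (hY : Y ∈ recipIdeal) (h : ModF X Y) :
    X ∈ recipIdeal := by
  have hfin : Summable ((X \ Y).indicator fun x : ℕ => (1 : ℝ) / x) :=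
    summable_of_hasFiniteSupport (h.subset Set.support_indicator_subset)
  refine ((Summable.indicator (hY : Summable _) X).add hfin).congr fun x => ?_
  by_cases hx : x ∈ X <;> by_cases hy : x ∈ Y <;> simp [hx, hy]

theorem mem_inter_of_modF_two_pow {X : Set ℕ} (hX : ModF X (Set.range (2 ^ · : ℕ → ℕ))) :
    X ∈ tileIdeal ∩ recipIdeal :=
  ⟨mem_tileIdeal_of_modF_two_pow hX, mem_recipIdeal_of_modF range_two_pow_mem_recipIdeal hX⟩

/-- The much larger inclusion `𝐟 ⋐ 𝐭 ∩ 𝐫`. -/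
theorem finIdeal_muchLarger_tile_inter_recip :
    MuchLarger finIdeal (tileIdeal ∩ recipIdeal) := by
  have hinj : Function.Injective (2 ^ · : ℕ → ℕ) := Nat.pow_right_injective le_rfl
  refine ⟨Set.ssubset_iff_subset_ne.2 ⟨fun X hX => mem_inter_of_modF_two_pow (hX.subset
    Set.sdiff_subset), fun h => ?_⟩, fun n => {2 ^ n}, fun n => Set.finite_singleton _,
    fun n => Set.singleton_nonempty _, fun m n hmn => ?_, fun K hK => ?_⟩
  · have hmem : Set.range (2 ^ · : ℕ → ℕ) ∈ finIdeal :=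
      h ▸ mem_inter_of_modF_two_pow (by simp [ModF])
    exact Set.infinite_range_of_injective hinj hmem
  · exact Set.disjoint_singleton.2 (hinj.ne hmn)
  · have himage : ⋃ k ∈ K, ({2 ^ k} : Set ℕ) = (2 ^ · : ℕ → ℕ) '' K :=
      (Set.image_eq_iUnion _ _).symm
    rw [himage]
    refine ⟨mem_inter_of_modF_two_pow ?_, hK.image hinj.injOn⟩
    rw [ModF, Set.sdiff_eq_empty.2 (Set.image_subset_range _ _)]
    exact Set.finite_empty
end

section
/- The much larger inclusion 𝐛 ⋐ 𝐝 holds: 𝐛 ⊊ 𝐝 and there exists a countable collection {D_j}_{j∈ℕ} ⊆ 𝐛 of nonempty pairwise disjoint subsets of ℕ such that for every infinite subset K ⊆ ℕ, the union ⋃_{k∈K} D_k belongs to 𝐝 \ 𝐛. -/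
open Filter

theorem cntI_le (X : Set ℕ) (k n : ℕ) : cntI X k n ≤ n := by
  have h := Set.ncard_le_ncard (Set.inter_subset_right (s := X) (t := Set.Icc (k + 1) (k + n)))
    (Set.finite_Icc _ _)
  have h2 : (Set.Icc (k + 1) (k + n)).ncard = n := by
    rw [← Finset.coe_Icc, Set.ncard_coe_finset, Nat.card_Icc]
    omega
  rw [h2] at h
  exact h

theorem bddAbove_cntI (X : Set ℕ) (n : ℕ) : BddAbove {m : ℕ | ∃ k : ℕ, m = cntI X k n} := by
  refine ⟨n, ?_⟩
  rintro m ⟨k, rfl⟩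
  exact cntI_le X k n

theorem cntI_le_maxCnt (X : Set ℕ) (k n : ℕ) : cntI X k n ≤ maxCnt X n :=
  le_csSup (bddAbove_cntI X n) ⟨k, rfl⟩

theorem cnt_le_maxCnt (X : Set ℕ) (n : ℕ) : cnt X n ≤ maxCnt X n := by
  simpa [cnt, cntI] using cntI_le_maxCnt X 0 n

theorem banachIdeal_subset_densIdeal : banachIdeal ⊆ densIdeal := by
  intro X hX
  refine squeeze_zero (fun n => by positivity) (fun n => ?_) hX
  have := cnt_le_maxCnt X n
  gcongr

theorem Set.Finite.mem_banachIdeal {X : Set ℕ} (hX : X.Finite) : X ∈ banachIdeal := by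
  refine squeeze_zero (fun n => by positivity) (fun n => ?_)
    (tendsto_const_div_atTop_nhds_zero_nat (X.ncard : ℝ))
  have : maxCnt X n ≤ X.ncard := by
    refine csSup_le ⟨_, 0, rfl⟩ ?_
    rintro m ⟨k, rfl⟩
    exact Set.ncard_le_ncard Set.inter_subset_left hX
  gcongr

/-- The interval of length `2 ^ n` starting at `4 ^ n + 2 ^ n`. -/
def sparseBlock (n : ℕ) : Set ℕ := Set.Ico (4 ^ n + 2 ^ n) (4 ^ n + 2 ^ (n + 1))

theorem sparseBlock_nonempty (n : ℕ) : (sparseBlock n).Nonempty := by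
  refine Set.nonempty_Ico.2 ?_
  have : 0 < 2 ^ n := by positivity
  rw [pow_succ]
  omega

theorem disjoint_sparseBlock_of_lt {m n : ℕ} (h : m < n) :
    Disjoint (sparseBlock m) (sparseBlock n) := by
  rw [Set.disjoint_left]
  intro x hx hx'
  have h4 : 4 ^ m ≤ 4 ^ n := Nat.pow_le_pow_right (by norm_num) h.le
  have h2 : 2 ^ (m + 1) ≤ 2 ^ n := Nat.pow_le_pow_right (by norm_num) h
  have := hx.2
  have := hx'.1
  omega

theorem cnt_iUnion_sparseBlock_le (K : Set ℕ) (N : ℕ) :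
    cnt (⋃ k ∈ K, sparseBlock k) N ≤ Nat.sqrt (4 * N) + 1 := by
  have hsub : (⋃ k ∈ K, sparseBlock k) ∩ Set.Icc 1 N ⊆
      ((Finset.range (Nat.sqrt (4 * N) + 1)).image fun m => 4 ^ Nat.log 2 m + m : Finset ℕ) := by
    rintro x ⟨hx, -, hxN⟩
    simp only [Set.mem_iUnion] at hx
    obtain ⟨k, -, hk, hk'⟩ := hx
    obtain ⟨m, rfl⟩ : ∃ m, x = 4 ^ k + m := ⟨x - 4 ^ k, by omega⟩
    have hm : 2 ^ k ≤ m := by omega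
    have hm' : m < 2 ^ (k + 1) := by omega
    have hlog : Nat.log 2 m = k := Nat.log_eq_of_pow_le_of_lt_pow hm hm'
    have hsq : m * m ≤ 4 * N := by
      have h1 : m * m ≤ 2 ^ (k + 1) * 2 ^ (k + 1) := Nat.mul_le_mul hm'.le hm'.le
      have h2 : 2 ^ (k + 1) * 2 ^ (k + 1) = 4 * 4 ^ k := by
        rw [← mul_pow, pow_succ]
        ring
      omega
    simp only [Finset.coe_image, Set.mem_image, Finset.coe_range, Set.mem_Iio]
    exact ⟨m, Nat.lt_succ_of_le (Nat.le_sqrt.2 hsq), by rw [hlog]⟩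
  have h := Set.ncard_le_ncard hsub (Finset.finite_toSet _)
  rw [Set.ncard_coe_finset] at h
  exact h.trans (Finset.card_image_le.trans (Finset.card_range _).le)

theorem iUnion_sparseBlock_mem_densIdeal (K : Set ℕ) :
    (⋃ k ∈ K, sparseBlock k) ∈ densIdeal := by
  have hlim : Tendsto (fun N : ℕ => 2 / √(N : ℝ) + 1 / (N : ℝ)) atTop (nhds 0) := by
    simpa using ((Real.tendsto_sqrt_atTop.comp
      tendsto_natCast_atTop_atTop).const_div_atTop (2 : ℝ)).add
        (tendsto_const_div_atTop_nhds_zero_nat (1 : ℝ))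
  refine squeeze_zero (fun n => by positivity) (fun N => ?_) hlim
  have hc : (cnt (⋃ k ∈ K, sparseBlock k) N : ℝ) ≤ 2 * √(N : ℝ) + 1 := by
    have h1 : (cnt (⋃ k ∈ K, sparseBlock k) N : ℝ) ≤ Nat.sqrt (4 * N) + 1 := by
      exact_mod_cast cnt_iUnion_sparseBlock_le K N
    have h2 : (Nat.sqrt (4 * N) : ℝ) ≤ √((4 * N : ℕ) : ℝ) := Real.nat_sqrt_le_real_sqrt
    have h3 : √((4 * N : ℕ) : ℝ) = 2 * √(N : ℝ) := by
      push_cast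
      rw [Real.sqrt_mul (by norm_num), show (4 : ℝ) = 2 ^ 2 by norm_num,
        Real.sqrt_sq (by norm_num)]
    linarith
  calc (cnt (⋃ k ∈ K, sparseBlock k) N : ℝ) / N ≤ (2 * √(N : ℝ) + 1) / N := by gcongr
    _ = 2 / √(N : ℝ) + 1 / (N : ℝ) := by
      rw [add_div, mul_div_assoc, Real.sqrt_div_self', mul_one_div]

theorem le_maxCnt_of_sparseBlock_subset {X : Set ℕ} {n : ℕ} (h : sparseBlock n ⊆ X) :
    2 ^ n ≤ maxCnt X (2 ^ n) := by
  refine le_trans ?_ (cntI_le_maxCnt X (4 ^ n + 2 ^ n - 1) (2 ^ n))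
  have hpos : 0 < 2 ^ n := by positivity
  have hpos4 : 0 < 4 ^ n := by positivity
  have hsub : sparseBlock n ⊆
      X ∩ Set.Icc (4 ^ n + 2 ^ n - 1 + 1) (4 ^ n + 2 ^ n - 1 + 2 ^ n) := by
    refine fun x hx => ⟨h hx, ?_⟩
    obtain ⟨h1, h2⟩ := hx
    rw [pow_succ] at h2
    constructor <;> omega
  have hcard := Set.ncard_le_ncard hsub ((Set.finite_Icc _ _).inter_of_right _)
  rw [sparseBlock, ← Finset.coe_Ico, Set.ncard_coe_finset, Nat.card_Ico, pow_succ] at hcard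
  refine le_trans ?_ hcard
  omega

theorem iUnion_sparseBlock_notMem_banachIdeal {K : Set ℕ} (hK : K.Infinite) :
    (⋃ k ∈ K, sparseBlock k) ∉ banachIdeal := by
  intro h
  have hpow := (Tendsto.comp h (tendsto_pow_atTop_atTop_of_one_lt (one_lt_two (α := ℕ))))
  obtain ⟨n, hn, hnK⟩ := ((hpow.eventually (gt_mem_nhds one_pos)).and_frequently
    (Nat.frequently_atTop_iff_infinite.2 hK)).exists
  have hle := le_maxCnt_of_sparseBlock_subset
    (Set.subset_biUnion_of_mem (u := sparseBlock) hnK)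
  simp only [Function.comp_apply] at hn
  rw [div_lt_one (by positivity)] at hn
  exact absurd hle (not_le.2 (by exact_mod_cast hn))

/-- The much larger inclusion `𝐛 ⋐ 𝐝`. -/
theorem banach_muchLarger_dens : MuchLarger banachIdeal densIdeal := by
  refine ⟨⟨banachIdeal_subset_densIdeal, fun h => ?_⟩, sparseBlock,
    fun n => (Set.finite_Ico _ _).mem_banachIdeal, sparseBlock_nonempty, fun m n hmn => ?_,
    fun K hK => ⟨iUnion_sparseBlock_mem_densIdeal K, iUnion_sparseBlock_notMem_banachIdeal hK⟩⟩
  · exact iUnion_sparseBlock_notMem_banachIdeal Set.infinite_univ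
      (h (iUnion_sparseBlock_mem_densIdeal Set.univ))
  · rcases hmn.lt_or_gt with hlt | hgt
    · exact disjoint_sparseBlock_of_lt hlt
    · exact (disjoint_sparseBlock_of_lt hgt).symm
end
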